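/- arXiv:2601.12590 — 2 statements merged into one kernel-verified Lean document; each statement's English description precedes it below -/
import Mathlib

section
/- Let n ≥ 1, let a₁, …, a_n, b be positive reals with b > a₁ + ⋯ + a_n, let α₁, …, α_n, β be real numbers, and let s be a real number with s > |β| − (α₁ + ⋯ + α_n). Then ∫₀^∞ x^{s−1} (∏_{j=1}^n I_{α_j}(a_j x)) K_β(b x) dx = (2^{s−2}/b^s) · Σ over all tuples (k₁, …, k_n) of non-negative integers of [Γ(K + (s + A + β)/2) Γ(K + (s + A − β)/2) / (∏_{j=1}^n k_j! Γ(α_j + k_j + 1))] · ∏_{j=1}^n (a_j/b)^{α_j + 2 k_j}, where K = k₁ + ⋯ + k_n and A = α₁ + ⋯ + α_n. -/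
open MeasureTheory Real

noncomputable def besselK (ν x : ℝ) : ℝ :=
  ∫ t in Set.Ioi (0:ℝ), Real.exp (-x * Real.cosh t) * Real.cosh (ν * t)
noncomputable def besselI (ν x : ℝ) : ℝ :=
  ∑' k : ℕ, (1 / ((k.factorial : ℝ) * Real.Gamma ((k : ℝ) + ν + 1))) * (x / 2) ^ (2 * (k : ℝ) + ν)

lemma integrableOn_and_integral_beta {p q : ℝ} (hp : 0 < p) (hq : 0 < q) :
    IntegrableOn (fun x : ℝ => x ^ (p - 1) * (1 - x) ^ (q - 1)) (Set.Ioo 0 1) ∧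
    ∫ x in Set.Ioo (0 : ℝ) 1, x ^ (p - 1) * (1 - x) ^ (q - 1) = Gamma p * Gamma q / Gamma (p + q) := by
  have h1 := ProbabilityTheory.lintegral_betaPDF_eq_one hp hq
  rw [ProbabilityTheory.lintegral_betaPDF] at h1
  have hB : 0 < ProbabilityTheory.beta p q := ProbabilityTheory.beta_pos hp hq
  set B := ProbabilityTheory.beta p q
  have hnn : 0 ≤ᵐ[volume.restrict (Set.Ioo (0 : ℝ) 1)]
      fun x : ℝ => 1 / B * x ^ (p - 1) * (1 - x) ^ (q - 1) := by
    filter_upwards [ae_restrict_mem measurableSet_Ioo] with x hx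
    have h0 : 0 < x := hx.1
    have h2 : 0 < 1 - x := by linarith [hx.2]
    simp only [Pi.zero_apply]
    positivity
  have hm : AEStronglyMeasurable (fun x : ℝ => 1 / B * x ^ (p - 1) * (1 - x) ^ (q - 1))
      (volume.restrict (Set.Ioo (0 : ℝ) 1)) := by
    apply Measurable.aestronglyMeasurable
    fun_prop
  have hint : IntegrableOn (fun x : ℝ => 1 / B * x ^ (p - 1) * (1 - x) ^ (q - 1))
      (Set.Ioo 0 1) := by
    refine ⟨hm, ?_⟩
    rw [hasFiniteIntegral_iff_ofReal hnn, h1]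
    exact ENNReal.one_lt_top
  have hval : ∫ x in Set.Ioo (0 : ℝ) 1, 1 / B * x ^ (p - 1) * (1 - x) ^ (q - 1) = 1 := by
    rw [integral_eq_lintegral_of_nonneg_ae hnn hm, h1, ENNReal.toReal_one]
  constructor
  · refine (hint.const_mul B).congr (Filter.Eventually.of_forall fun x => ?_)
    simp only
    field_simp
  · simp only [mul_assoc] at hval
    rw [integral_const_mul] at hval
    have : B = Gamma p * Gamma q / Gamma (p + q) := rfl
    rw [← this]
    field_simp at hval
    exact hval

lemma sigmoid_two_mul (t : ℝ) : sigmoid (2 * t) = exp t / (2 * cosh t) := by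
  rw [sigmoid_def, cosh_eq, show -(2 * t) = -t + -t by ring, exp_add]
  have : exp t * exp (-t) = 1 := by rw [← exp_add]; simp
  have h1 := exp_pos t
  have h2 := exp_pos (-t)
  field_simp
  linear_combination (-exp (-t)) * this

lemma abs_deriv_sigmoid_mul_beta_integrand (p q t : ℝ) :
    |2 * (sigmoid (2 * t) * (1 - sigmoid (2 * t)))| •
        (sigmoid (2 * t) ^ (p - 1) * (1 - sigmoid (2 * t)) ^ (q - 1))
      = 2 ^ (1 - (p + q)) * (exp ((p - q) * t) * cosh t ^ (-(p + q))) := by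
  rw [← sigmoid_neg, ← mul_neg, sigmoid_two_mul, sigmoid_two_mul, cosh_neg]
  have hc := cosh_pos t
  have hu : 0 < exp t / (2 * cosh t) := by positivity
  have hv : 0 < exp (-t) / (2 * cosh t) := by positivity
  rw [abs_of_pos (by positivity), smul_eq_mul, rpow_sub_one hu.ne', rpow_sub_one hv.ne',
    div_rpow (exp_pos _).le (by positivity), div_rpow (exp_pos _).le (by positivity),
    ← exp_mul, ← exp_mul, show (p - q) * t = t * p + -t * q by ring, exp_add,
    rpow_neg hc.le, rpow_sub two_pos, rpow_add two_pos, rpow_add hc,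
    mul_rpow two_pos.le hc.le, mul_rpow two_pos.le hc.le, rpow_one]
  field_simp

lemma integrable_and_integral_exp_mul_cosh_rpow {p q : ℝ} (hp : 0 < p) (hq : 0 < q) :
    Integrable (fun t : ℝ => exp ((p - q) * t) * cosh t ^ (-(p + q))) ∧
    ∫ t : ℝ, exp ((p - q) * t) * cosh t ^ (-(p + q))
      = 2 ^ (p + q - 1) * (Gamma p * Gamma q / Gamma (p + q)) := by
  obtain ⟨hi, hv⟩ := integrableOn_and_integral_beta hp hq
  have hd : ∀ t ∈ (Set.univ : Set ℝ), HasDerivWithinAt (fun t : ℝ => sigmoid (2 * t))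
      (2 * (sigmoid (2 * t) * (1 - sigmoid (2 * t)))) Set.univ t := by
    intro t _
    have := (hasDerivAt_sigmoid (2 * t)).comp t ((hasDerivAt_id t).const_mul 2)
    refine HasDerivAt.hasDerivWithinAt (this.congr_deriv ?_)
    ring
  have hinj : Set.InjOn (fun t : ℝ => sigmoid (2 * t)) Set.univ := by
    intro x _ y _ h
    simpa using sigmoid_injective h
  have himg : (fun t : ℝ => sigmoid (2 * t)) '' Set.univ = Set.Ioo 0 1 := by
    rw [← range_sigmoid, Set.image_univ]
    exact (mul_left_surjective₀ (two_ne_zero' ℝ)).range_comp sigmoid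
  have hc : (2 : ℝ) ^ (p + q - 1) * 2 ^ (1 - (p + q)) = 1 := by
    rw [← rpow_add two_pos]; simp
  have hi2 := (integrableOn_image_iff_integrableOn_abs_deriv_smul MeasurableSet.univ hd hinj
    (fun x : ℝ => x ^ (p - 1) * (1 - x) ^ (q - 1)))
  have hv2 := (integral_image_eq_integral_abs_deriv_smul MeasurableSet.univ hd hinj
    (fun x : ℝ => x ^ (p - 1) * (1 - x) ^ (q - 1)))
  simp only [himg, abs_deriv_sigmoid_mul_beta_integrand, integrableOn_univ,
    Measure.restrict_univ] at hi2 hv2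
  constructor
  · refine ((hi2.mp hi).const_mul (2 ^ (p + q - 1))).congr (Filter.Eventually.of_forall fun t => ?_)
    simp only [← mul_assoc, hc, one_mul]
  · rw [← hv, hv2, integral_const_mul, ← mul_assoc, hc, one_mul]

lemma integrableOn_and_integral_cosh_mul_cosh_rpow {μ β : ℝ} (h : |β| < μ) :
    IntegrableOn (fun t : ℝ => cosh (β * t) * cosh t ^ (-μ)) (Set.Ioi 0) ∧
    ∫ t in Set.Ioi (0 : ℝ), cosh (β * t) * cosh t ^ (-μ)
      = 2 ^ (μ - 2) * (Gamma ((μ + β) / 2) * Gamma ((μ - β) / 2) / Gamma μ) := by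
  obtain ⟨h1, h2⟩ := abs_lt.mp h
  obtain ⟨hi, hv⟩ := integrable_and_integral_exp_mul_cosh_rpow
    (p := (μ + β) / 2) (q := (μ - β) / 2) (by linarith) (by linarith)
  rw [show (μ + β) / 2 - (μ - β) / 2 = β by ring, show (μ + β) / 2 + (μ - β) / 2 = μ by ring]
    at hi hv
  have hi' := hi.comp_neg
  have heq : ∀ t : ℝ, cosh (β * t) * cosh t ^ (-μ) =
      1 / 2 * (exp (β * t) * cosh t ^ (-μ) + exp (β * -t) * cosh (-t) ^ (-μ)) := by
    intro t
    rw [cosh_neg, cosh_eq (β * t), mul_neg]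
    ring
  simp only [heq]
  constructor
  · exact ((hi.add hi').const_mul (1 / 2)).integrableOn
  · rw [integral_const_mul, integral_add hi.integrableOn hi'.integrableOn,
      integral_comp_neg_Ioi (c := (0 : ℝ)) (f := fun t => exp (β * t) * cosh t ^ (-μ)), neg_zero,
      add_comm, intervalIntegral.integral_Iic_add_Ioi hi.integrableOn hi.integrableOn, hv,
      show μ - 1 = μ - 2 + 1 by ring, rpow_add_one two_ne_zero]
    ring

lemma integrable_prod_and_mellin_besselK {μ β b : ℝ} (h : |β| < μ) (hb : 0 < b) :
    Integrable (Function.uncurry fun x t : ℝ =>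
        x ^ (μ - 1) * (exp (-(b * x) * cosh t) * cosh (β * t)))
      ((volume.restrict (Set.Ioi 0)).prod (volume.restrict (Set.Ioi 0))) ∧
    ∫ t in Set.Ioi (0 : ℝ), ∫ x in Set.Ioi (0 : ℝ),
        x ^ (μ - 1) * (exp (-(b * x) * cosh t) * cosh (β * t))
      = 2 ^ (μ - 2) * b ^ (-μ) * (Gamma ((μ + β) / 2) * Gamma ((μ - β) / 2)) := by
  have hμ : 0 < μ := (abs_nonneg β).trans_lt h
  have hform : ∀ x t : ℝ, x ^ (μ - 1) * (exp (-(b * x) * cosh t) * cosh (β * t))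
      = cosh (β * t) * (x ^ (μ - 1) * exp (-(b * cosh t * x))) := by
    intro x t
    rw [show -(b * x) * cosh t = -(b * cosh t * x) by ring]
    ring
  have hinner : ∀ t : ℝ, ∫ x in Set.Ioi (0 : ℝ),
      x ^ (μ - 1) * (exp (-(b * x) * cosh t) * cosh (β * t))
      = b ^ (-μ) * Gamma μ * (cosh (β * t) * cosh t ^ (-μ)) := by
    intro t
    have hc := cosh_pos t
    simp only [hform]
    rw [integral_const_mul, integral_rpow_mul_exp_neg_mul_Ioi hμ (by positivity), one_div,
      inv_rpow (by positivity), ← rpow_neg (by positivity), mul_rpow hb.le hc.le]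
    ring
  obtain ⟨hi, hv⟩ := integrableOn_and_integral_cosh_mul_cosh_rpow h
  constructor
  · rw [integrable_prod_iff']
    · constructor
      · refine Filter.Eventually.of_forall fun t => ?_
        have hc := cosh_pos t
        simp only [Function.uncurry_apply_pair, hform]
        refine Integrable.const_mul ?_ _
        simpa [IntegrableOn] using integrableOn_rpow_mul_exp_neg_mul_rpow (p := 1) (s := μ - 1)
          (b := b * cosh t) (by linarith) one_pos (by positivity)
      · refine (hi.const_mul (b ^ (-μ) * Gamma μ)).congr (Filter.Eventually.of_forall fun t => ?_)
        simp only [Function.uncurry_apply_pair]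
        rw [← hinner t]
        refine setIntegral_congr_fun measurableSet_Ioi fun x hx => ?_
        have hx' : (0 : ℝ) < x := hx
        have := cosh_pos (β * t)
        exact (norm_of_nonneg (by positivity)).symm
    · apply Measurable.aestronglyMeasurable
      unfold Function.uncurry
      fun_prop
  · simp only [hinner]
    have := (Gamma_pos_of_pos hμ).ne'
    rw [integral_const_mul, hv]
    field_simp

lemma rpow_mul_besselK_eq (μ β b x : ℝ) :
    x ^ (μ - 1) * besselK β (b * x) = ∫ t in Set.Ioi (0 : ℝ),
      x ^ (μ - 1) * (exp (-(b * x) * cosh t) * cosh (β * t)) := by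
  rw [besselK, integral_const_mul]

lemma integrableOn_rpow_mul_besselK {μ β b : ℝ} (h : |β| < μ) (hb : 0 < b) :
    IntegrableOn (fun x : ℝ => x ^ (μ - 1) * besselK β (b * x)) (Set.Ioi 0) := by
  simp only [rpow_mul_besselK_eq]
  exact (integrable_prod_and_mellin_besselK h hb).1.integral_prod_left

/-- The Mellin transform of `x ↦ K_β (b x)`. -/
lemma integral_rpow_mul_besselK {μ β b : ℝ} (h : |β| < μ) (hb : 0 < b) :
    ∫ x in Set.Ioi (0 : ℝ), x ^ (μ - 1) * besselK β (b * x)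
      = 2 ^ (μ - 2) * b ^ (-μ) * (Gamma ((μ + β) / 2) * Gamma ((μ - β) / 2)) := by
  obtain ⟨hi, hv⟩ := integrable_prod_and_mellin_besselK h hb
  simp only [rpow_mul_besselK_eq]
  rw [integral_integral_swap hi, hv]

lemma besselK_nonneg (ν x : ℝ) : 0 ≤ besselK ν x :=
  integral_nonneg fun _ => mul_nonneg (exp_pos _).le (cosh_pos _).le

lemma measurable_besselK (ν : ℝ) : Measurable (besselK ν) := by
  have : StronglyMeasurable (Function.uncurry fun x t : ℝ =>
      exp (-x * cosh t) * cosh (ν * t)) := by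
    apply Measurable.stronglyMeasurable
    unfold Function.uncurry
    fun_prop
  exact (this.integral_prod_right (ν := volume.restrict (Set.Ioi (0 : ℝ)))).measurable

lemma integrableOn_exp_mul_cosh (ν : ℝ) {x : ℝ} (hx : 0 < x) :
    IntegrableOn (fun t : ℝ => exp (-x * cosh t) * cosh (ν * t)) (Set.Ioi 0) := by
  obtain ⟨hi, -⟩ := integrableOn_and_integral_cosh_mul_cosh_rpow (lt_add_one |ν|)
  set μ := |ν| + 1
  have hμ : 0 < μ := by positivity
  refine (hi.const_mul ((μ / x) ^ μ)).mono' (by fun_prop)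
    (Filter.Eventually.of_forall fun t => ?_)
  have hc := cosh_pos t
  have hcν := cosh_pos (ν * t)
  rw [norm_of_nonneg (by positivity), mul_comm (cosh _), ← mul_assoc]
  gcongr
  have hy : 0 < x * cosh t / μ := by positivity
  have h1 : (x * cosh t / μ) ^ μ ≤ exp (x * cosh t) := by
    calc (x * cosh t / μ) ^ μ ≤ (exp (x * cosh t / μ)) ^ μ := by
          gcongr
          linarith [add_one_le_exp (x * cosh t / μ)]
      _ = exp (x * cosh t) := by
          rw [← exp_mul]
          congr 1
          field_simp
  calc exp (-x * cosh t) = (exp (x * cosh t))⁻¹ := by rw [← exp_neg]; ring_nf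
    _ ≤ ((x * cosh t / μ) ^ μ)⁻¹ := by gcongr
    _ = (μ / x) ^ μ * cosh t ^ (-μ) := by
      rw [rpow_neg hc.le, ← inv_rpow hy.le, ← inv_rpow hc.le,
        ← mul_rpow (by positivity) (by positivity)]
      congr 1
      field_simp

lemma exp_mul_besselK_le (ν : ℝ) {b c x : ℝ} (hc : 0 ≤ c) (hcb : c < b) (hx : 0 < x) :
    exp (c * x) * besselK ν (b * x) ≤ besselK ν ((b - c) * x) := by
  rw [besselK, besselK, ← integral_const_mul]
  refine integral_mono ((integrableOn_exp_mul_cosh ν (mul_pos (hc.trans_lt hcb) hx)).const_mul _)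
    (integrableOn_exp_mul_cosh ν (mul_pos (sub_pos.mpr hcb) hx)) fun t => ?_
  have hcν := cosh_pos (ν * t)
  simp only
  rw [← mul_assoc, ← exp_add]
  gcongr
  nlinarith [mul_nonneg (mul_nonneg hc hx.le) (sub_nonneg.mpr (one_le_cosh t))]

lemma hasSum_pi_prod : ∀ {n : ℕ} {f : Fin n → ℕ → ℝ} {S : Fin n → ℝ},
    (∀ j, HasSum (f j) (S j)) → (∀ j, Summable fun k => ‖f j k‖) →
    HasSum (fun k : Fin n → ℕ => ∏ j, f j (k j)) (∏ j, S j) ∧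
      Summable fun k : Fin n → ℕ => ‖∏ j, f j (k j)‖
  | 0, f, S, _, _ => by simp [hasSum_unique, Summable.of_finite]
  | n + 1, f, S, hS, hf => by
    obtain ⟨h1, h2⟩ := hasSum_pi_prod (fun j => hS j.succ) (fun j => hf j.succ)
    have hs := summable_mul_of_summable_norm (hf 0) h2
    have hp := (hS 0).mul h1 hs
    have hn := (hf 0).mul_norm h2
    rw [← (Fin.consEquiv fun _ => ℕ).hasSum_iff, ← (Fin.consEquiv fun _ => ℕ).summable_iff]
    simp only [Function.comp_def, Fin.prod_univ_succ, Fin.consEquiv_apply, Fin.cons_zero,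
      Fin.cons_succ]
    exact ⟨hp, hn⟩

/-- Up to a geometric factor, the coefficients of `I_ν` are bounded by those of `cosh`. -/
lemma exists_besselI_coeff_le (ν : ℝ) {σ : ℝ} (hσ : 1 < σ) :
    ∃ C, 0 ≤ C ∧ ∀ k : ℕ, |1 / ((k.factorial : ℝ) * Gamma ((k : ℝ) + ν + 1))|
      ≤ C * ((2 * σ) ^ (2 * k) / (2 * k).factorial) := by
  have hσ0 : 0 < σ := one_pos.trans hσ
  set f : ℕ → ℝ := fun k => |1 / ((k.factorial : ℝ) * Gamma ((k : ℝ) + ν + 1))| *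
    ((2 * k).factorial / (2 * σ) ^ (2 * k)) with hf
  have hf0 : ∀ k, 0 ≤ f k := fun k => by positivity
  have hsum : Summable f := by
    refine summable_of_ratio_norm_eventually_le (r := σ⁻¹) (inv_lt_one_of_one_lt₀ hσ) ?_
    obtain ⟨N, hN⟩ := exists_nat_gt ((1 + σ * (|ν| + 1)) / (σ - 1))
    filter_upwards [Filter.eventually_ge_atTop N] with k hk
    have hk' : (N : ℝ) ≤ k := by exact_mod_cast hk
    have hlt : 1 + σ * (|ν| + 1) < k * (σ - 1) := by
      rw [div_lt_iff₀ (by linarith)] at hN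
      nlinarith
    have hν := neg_abs_le ν
    have hpos : 0 < (k : ℝ) + ν + 1 := by
      have : |ν| + 1 < k := lt_of_mul_lt_mul_right (a := σ - 1)
        (by nlinarith [abs_nonneg ν]) (by linarith)
      linarith
    have hG : Gamma (((k + 1 : ℕ) : ℝ) + ν + 1) = ((k : ℝ) + ν + 1) * Gamma ((k : ℝ) + ν + 1) := by
      rw [← Gamma_add_one hpos.ne']
      push_cast
      ring_nf
    have hGpos := Gamma_pos_of_pos hpos
    have hfac : (((2 * (k + 1)).factorial : ℕ) : ℝ)
        = (2 * k + 2) * (2 * k + 1) * (2 * k).factorial := by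
      rw [show 2 * (k + 1) = 2 * k + 1 + 1 by ring, Nat.factorial_succ, Nat.factorial_succ]
      push_cast
      ring
    rw [norm_of_nonneg (hf0 _), norm_of_nonneg (hf0 _)]
    have hratio : f (k + 1) = (k + 1 / 2) / (σ ^ 2 * (k + ν + 1)) * f k := by
      simp only [hf]
      rw [hG, hfac, Nat.factorial_succ, abs_of_pos (by positivity), abs_of_pos (by positivity),
        show 2 * (k + 1) = 2 * k + 2 by ring, pow_add]
      push_cast
      field_simp
    rw [hratio]
    refine mul_le_mul_of_nonneg_right ?_ (hf0 k)
    rw [inv_eq_one_div, div_le_div_iff₀ (by positivity) hσ0]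
    have : (k : ℝ) + 1 / 2 ≤ σ * (k + ν + 1) := by nlinarith
    nlinarith
  refine ⟨∑' k, f k, tsum_nonneg hf0, fun k => ?_⟩
  have hle := hsum.le_tsum k fun j _ => hf0 j
  have hp : (0 : ℝ) < (2 * σ) ^ (2 * k) / (2 * k).factorial := by positivity
  calc _ = f k * ((2 * σ) ^ (2 * k) / (2 * k).factorial) := by
        simp only [hf]
        field_simp
    _ ≤ _ := by gcongr

/-- The `k`-th term of the power series defining `besselI ν x`. -/
noncomputable def besselITerm (ν x : ℝ) (k : ℕ) : ℝ :=
  (1 / ((k.factorial : ℝ) * Gamma ((k : ℝ) + ν + 1))) * (x / 2) ^ (2 * (k : ℝ) + ν)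

lemma norm_besselITerm_le {ν σ C : ℝ}
    (hC : ∀ k : ℕ, |1 / ((k.factorial : ℝ) * Gamma ((k : ℝ) + ν + 1))|
      ≤ C * ((2 * σ) ^ (2 * k) / (2 * k).factorial)) {x : ℝ} (hx : 0 < x) (k : ℕ) :
    ‖besselITerm ν x k‖ ≤ C * (x / 2) ^ ν * ((σ * x) ^ (2 * k) / (2 * k).factorial) := by
  have hx2 : 0 < x / 2 := by positivity
  rw [besselITerm, norm_mul, norm_eq_abs, norm_of_nonneg (by positivity)]
  calc _ ≤ C * ((2 * σ) ^ (2 * k) / (2 * k).factorial) * (x / 2) ^ (2 * (k : ℝ) + ν) := by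
        gcongr
        exact hC k
    _ = _ := by
      rw [rpow_add hx2, show (2 * (k : ℝ)) = ((2 * k : ℕ) : ℝ) by push_cast; rfl, rpow_natCast,
        show σ * x = 2 * σ * (x / 2) by ring, mul_pow (2 * σ)]
      ring

lemma summable_norm_besselITerm (ν : ℝ) {x : ℝ} (hx : 0 < x) :
    Summable fun k => ‖besselITerm ν x k‖ := by
  obtain ⟨C, -, hC⟩ := exists_besselI_coeff_le ν one_lt_two
  exact Summable.of_nonneg_of_le (fun _ => norm_nonneg _) (norm_besselITerm_le hC hx)
    ((hasSum_cosh _).summable.mul_left _)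

lemma hasSum_besselITerm (ν : ℝ) {x : ℝ} (hx : 0 < x) :
    HasSum (besselITerm ν x) (besselI ν x) :=
  (summable_norm_besselITerm ν hx).of_norm.hasSum

lemma integral_rpow_mul_prod_besselITerm_mul_besselK {n : ℕ} {a α : Fin n → ℝ} {b β s : ℝ}
    (ha : ∀ j, 0 < a j) (hb : 0 < b) (hs : |β| - ∑ j, α j < s) (k : Fin n → ℕ) :
    ∫ x in Set.Ioi (0 : ℝ),
        x ^ (s - 1) * (∏ j, besselITerm (α j) (a j * x) (k j)) * besselK β (b * x)
      = ((2 : ℝ) ^ (s - 2) / b ^ s) *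
        ((Gamma ((∑ j, (k j : ℝ)) + (s + (∑ j, α j) + β) / 2)
          * Gamma ((∑ j, (k j : ℝ)) + (s + (∑ j, α j) - β) / 2)
          / ∏ j, ((k j).factorial : ℝ) * Gamma (α j + (k j : ℝ) + 1))
        * ∏ j, (a j / b) ^ (α j + 2 * (k j : ℝ))) := by
  set E : ℝ := ∑ j, (α j + 2 * (k j : ℝ)) with hE
  have hE' : E = ∑ j, α j + 2 * ∑ j, (k j : ℝ) := by
    rw [hE, Finset.sum_add_distrib, Finset.mul_sum]
  have hK : 0 ≤ ∑ j, (k j : ℝ) := Finset.sum_nonneg fun j _ => Nat.cast_nonneg _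
  have hμ : |β| < s + E := by rw [hE']; linarith
  have hx : ∀ x ∈ Set.Ioi (0 : ℝ),
      x ^ (s - 1) * (∏ j, besselITerm (α j) (a j * x) (k j)) * besselK β (b * x)
      = (∏ j, (a j / 2) ^ (α j + 2 * (k j : ℝ)) /
          (((k j).factorial : ℝ) * Gamma (α j + (k j : ℝ) + 1))) *
        (x ^ (s + E - 1) * besselK β (b * x)) := by
    intro x hx
    have hx0 : (0 : ℝ) < x := hx
    rw [show s + E - 1 = s - 1 + E by ring, rpow_add hx0, hE, rpow_sum_of_pos hx0]
    have : ∀ j, besselITerm (α j) (a j * x) (k j) = (a j / 2) ^ (α j + 2 * (k j : ℝ)) /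
          (((k j).factorial : ℝ) * Gamma (α j + (k j : ℝ) + 1)) * x ^ (α j + 2 * (k j : ℝ)) := by
      intro j
      have := ha j
      rw [besselITerm, show a j * x / 2 = a j / 2 * x by ring,
        mul_rpow (by positivity) hx0.le, add_comm (k j : ℝ), add_comm (2 * (k j : ℝ))]
      ring
    simp only [this, Finset.prod_mul_distrib]
    ring
  have hprod : ∏ j, (a j / b) ^ (α j + 2 * (k j : ℝ))
      = (∏ j, (a j / 2) ^ (α j + 2 * (k j : ℝ))) * (2 ^ E * b ^ (-E)) := by
    rw [rpow_neg hb.le, ← inv_rpow hb.le, hE, rpow_sum_of_pos two_pos,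
      rpow_sum_of_pos (inv_pos.mpr hb), ← Finset.prod_mul_distrib, ← Finset.prod_mul_distrib]
    refine Finset.prod_congr rfl fun j _ => ?_
    have := ha j
    rw [← mul_rpow two_pos.le (by positivity), ← mul_rpow (by positivity) (by positivity)]
    congr 1
    field_simp
  rw [setIntegral_congr_fun measurableSet_Ioi hx, integral_const_mul,
    integral_rpow_mul_besselK hμ hb, hprod, Finset.prod_div_distrib,
    show s + E - 2 = s - 2 + E by ring, rpow_add two_pos, neg_add, rpow_add hb, rpow_neg hb.le s,
    show (s + E + β) / 2 = (∑ j, (k j : ℝ)) + (s + (∑ j, α j) + β) / 2 by rw [hE']; ring,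
    show (s + E - β) / 2 = (∑ j, (k j : ℝ)) + (s + (∑ j, α j) - β) / 2 by rw [hE']; ring]
  ring

lemma integrableOn_rpow_mul_prod_cosh_mul_besselK {n : ℕ} {a α : Fin n → ℝ} {b β s σ : ℝ}
    (C : Fin n → ℝ) (ha : ∀ j, 0 < a j) (hσ : 0 ≤ σ) (hb : σ * ∑ j, a j < b)
    (hs : |β| - ∑ j, α j < s) :
    IntegrableOn (fun x : ℝ => x ^ (s - 1) *
      (∏ j, C j * (a j * x / 2) ^ α j * cosh (σ * (a j * x))) * besselK β (b * x))
      (Set.Ioi 0) := by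
  have hT : 0 ≤ σ * ∑ j, a j := mul_nonneg hσ (Finset.sum_nonneg fun j _ => (ha j).le)
  have hμ : |β| < s + ∑ j, α j := by linarith
  have hK := measurable_besselK β
  refine ((integrableOn_rpow_mul_besselK hμ (sub_pos.mpr hb)).const_mul
    |∏ j, C j * (a j / 2) ^ α j|).mono' (by fun_prop) ?_
  filter_upwards [ae_restrict_mem measurableSet_Ioi] with x hx
  have hx0 : (0 : ℝ) < x := hx
  have hcosh : ∏ j, cosh (σ * (a j * x)) ≤ exp (σ * (∑ j, a j) * x) := by
    rw [show σ * (∑ j, a j) * x = ∑ j, σ * (a j * x) by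
      rw [Finset.mul_sum, Finset.sum_mul]; simp only [mul_assoc], exp_sum]
    refine Finset.prod_le_prod (fun j _ => (cosh_pos _).le) fun j _ => ?_
    have h0 : 0 ≤ σ * (a j * x) := mul_nonneg hσ (mul_pos (ha j) hx0).le
    rw [cosh_eq]
    have : exp (-(σ * (a j * x))) ≤ exp (σ * (a j * x)) := exp_le_exp.mpr (by linarith)
    linarith
  have hsplit : ∏ j, C j * (a j * x / 2) ^ α j * cosh (σ * (a j * x))
      = (∏ j, C j * (a j / 2) ^ α j) * x ^ (∑ j, α j) * ∏ j, cosh (σ * (a j * x)) := by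
    rw [rpow_sum_of_pos hx0, ← Finset.prod_mul_distrib, ← Finset.prod_mul_distrib]
    refine Finset.prod_congr rfl fun j _ => ?_
    have := ha j
    rw [show a j * x / 2 = a j / 2 * x by ring, mul_rpow (by positivity) hx0.le]
    ring
  have hcpos : 0 ≤ ∏ j, cosh (σ * (a j * x)) := Finset.prod_nonneg fun j _ => (cosh_pos _).le
  rw [hsplit, show s + ∑ j, α j - 1 = s - 1 + ∑ j, α j by ring, rpow_add hx0]
  simp only [norm_mul, norm_eq_abs]
  rw [abs_of_nonneg (besselK_nonneg β _), abs_of_nonneg hcpos, abs_of_pos (rpow_pos_of_pos hx0 _),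
    abs_of_pos (rpow_pos_of_pos hx0 _)]
  calc _ = |∏ j, C j * (a j / 2) ^ α j| * (x ^ (s - 1) * x ^ (∑ j, α j) *
        ((∏ j, cosh (σ * (a j * x))) * besselK β (b * x))) := by ring
    _ ≤ _ := by
      gcongr
      exact (mul_le_mul_of_nonneg_right hcosh (besselK_nonneg β _)).trans
        (exp_mul_besselK_le β hT hb hx0)

theorem stmt1 (n : ℕ) (hn : 1 ≤ n) (a : Fin n → ℝ) (b : ℝ) (α : Fin n → ℝ) (β s : ℝ)
    (ha : ∀ j, 0 < a j) (hb : (∑ j, a j) < b)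
    (hs : s > |β| - ∑ j, α j) :
    (∫ x in Set.Ioi (0:ℝ), x ^ (s - 1) * (∏ j, besselI (α j) (a j * x)) * besselK β (b * x))
    = ((2 : ℝ) ^ (s - 2) / b ^ s) * ∑' k : Fin n → ℕ,
        (Real.Gamma ((∑ j, (k j : ℝ)) + (s + (∑ j, α j) + β) / 2)
          * Real.Gamma ((∑ j, (k j : ℝ)) + (s + (∑ j, α j) - β) / 2)
          / ∏ j, ((k j).factorial : ℝ) * Real.Gamma (α j + (k j : ℝ) + 1))
        * ∏ j, (a j / b) ^ (α j + 2 * (k j : ℝ)) := by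
  have hT : 0 < ∑ j, a j :=
    Finset.sum_pos (fun j _ => ha j) ⟨⟨0, hn⟩, Finset.mem_univ _⟩
  obtain ⟨σ, hσ1, hσ⟩ := exists_between ((one_lt_div hT).mpr hb)
  have hσ0 : 0 < σ := one_pos.trans hσ1
  rw [lt_div_iff₀ hT] at hσ
  choose C hC0 hC using fun j => exists_besselI_coeff_le (α j) hσ1
  set μ := volume.restrict (Set.Ioi (0 : ℝ))
  have hpos : ∀ᵐ x ∂μ, 0 < x := ae_restrict_mem measurableSet_Ioi
  let bound : (Fin n → ℕ) → ℝ → ℝ := fun k x => x ^ (s - 1) *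
    (∏ j, C j * (a j * x / 2) ^ α j * ((σ * (a j * x)) ^ (2 * k j) / (2 * k j).factorial)) *
    besselK β (b * x)
  have hbound : ∀ᵐ x ∂μ, HasSum (fun k => bound k x) (x ^ (s - 1) *
      (∏ j, C j * (a j * x / 2) ^ α j * cosh (σ * (a j * x))) * besselK β (b * x)) := by
    filter_upwards [hpos] with x hx
    have h : ∀ j, HasSum (fun k : ℕ => C j * (a j * x / 2) ^ α j *
        ((σ * (a j * x)) ^ (2 * k) / (2 * k).factorial))
        (C j * (a j * x / 2) ^ α j * cosh (σ * (a j * x))) := fun j => (hasSum_cosh _).mul_left _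
    exact ((hasSum_pi_prod h fun j => (h j).summable.norm).1.mul_left _).mul_right _
  have key := hasSum_integral_of_dominated_convergence (μ := μ) (F := fun (k : Fin n → ℕ) x =>
      x ^ (s - 1) * (∏ j, besselITerm (α j) (a j * x) (k j)) * besselK β (b * x))
    (f := fun x => x ^ (s - 1) * (∏ j, besselI (α j) (a j * x)) * besselK β (b * x)) bound
    (fun k => ?_) (fun k => ?_) (hbound.mono fun x hx => hx.summable) ?_ ?_
  · simp only [μ, integral_rpow_mul_prod_besselITerm_mul_besselK ha (hT.trans hb) hs] at key
    rw [← key.tsum_eq, tsum_mul_left]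
  · have hK := measurable_besselK β
    unfold besselITerm
    fun_prop
  · filter_upwards [hpos] with x hx
    rw [norm_mul, norm_mul, norm_of_nonneg (besselK_nonneg β _),
      norm_of_nonneg (rpow_nonneg hx.le _), norm_prod]
    refine mul_le_mul_of_nonneg_right (mul_le_mul_of_nonneg_left ?_ (rpow_nonneg hx.le _))
      (besselK_nonneg β _)
    exact Finset.prod_le_prod (fun j _ => norm_nonneg _) fun j _ =>
      norm_besselITerm_le (hC j) (mul_pos (ha j) hx) (k j)
  · refine (integrableOn_rpow_mul_prod_cosh_mul_besselK C ha hσ0.le hσ hs).congr ?_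
    filter_upwards [hbound] with x hx using hx.tsum_eq.symm
  · filter_upwards [hpos] with x hx
    exact ((hasSum_pi_prod (fun j => hasSum_besselITerm (α j) (mul_pos (ha j) hx))
      fun j => summable_norm_besselITerm (α j) (mul_pos (ha j) hx)).1.mul_left _).mul_right _
end

section
/- Let a > 0 be real. Then ∫₀^∞ x K₀⁴(a x) dx = (7/(8a²)) ζ(3), where ζ(3) = Σ_{k=1}^∞ 1/k³. -/
open MeasureTheory Real

open ENNReal

lemma lintegral_comp_two_mul {f : ℝ → ℝ≥0∞} (hf : Measurable f) :
    ∫⁻ x, f x = 2 * ∫⁻ x, f (2 * x) := by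
  have h := Real.smul_map_volume_mul_left (a := 2) two_ne_zero
  conv_lhs => rw [← h]
  rw [lintegral_smul_measure, lintegral_map hf (measurable_const_mul 2)]
  simp

lemma lintegral_lintegral_add_sub {F : ℝ → ℝ → ℝ≥0∞} (hF : Measurable (Function.uncurry F)) :
    ∫⁻ s, ∫⁻ t, F s t = 2 * ∫⁻ u, ∫⁻ v, F (u + v) (u - v) := by
  have hcomp : ∀ {f : ℝ × ℝ → ℝ × ℝ}, Measurable f →
      Measurable fun z => F (f z).1 (f z).2 := fun hf => hF.comp hf
  have hF1 : ∀ t, Measurable fun s => F s t :=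
    fun t => hF.comp (by fun_prop : Measurable fun s : ℝ => (s, t))
  calc ∫⁻ s, ∫⁻ t, F s t = ∫⁻ t, ∫⁻ s, F s t :=
        lintegral_lintegral_swap hF.aemeasurable
    _ = ∫⁻ t, 2 * ∫⁻ v, F (2 * v + t) t := by
        congr 1 with t
        rw [← lintegral_add_right_eq_self _ t]
        exact lintegral_comp_two_mul ((hF1 t).comp (measurable_add_const t))
    _ = 2 * ∫⁻ t, ∫⁻ v, F (2 * v + t) t := by
        rw [lintegral_const_mul]
        exact Measurable.lintegral_prod_right
          (hcomp (f := fun z => (2 * z.2 + z.1, z.1)) (by fun_prop))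
    _ = 2 * ∫⁻ v, ∫⁻ t, F (2 * v + t) t := by
        rw [lintegral_lintegral_swap]
        exact (hcomp (f := fun z => (2 * z.2 + z.1, z.1)) (by fun_prop)).aemeasurable
    _ = 2 * ∫⁻ v, ∫⁻ u, F (u + v) (u - v) := by
        congr 2 with v
        rw [← lintegral_sub_right_eq_self _ v]
        congr 1 with u
        congr 1
        ring
    _ = _ := by
        rw [lintegral_lintegral_swap]
        exact (hcomp (f := fun z => (z.2 + z.1, z.2 - z.1)) (by fun_prop)).aemeasurable

lemma lintegral_mul_lintegral {f g : ℝ → ℝ≥0∞} (hf : Measurable f) (hg : Measurable g) :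
    (∫⁻ x, f x) * ∫⁻ y, g y = ∫⁻ x, ∫⁻ y, f x * g y := by
  simp_rw [lintegral_const_mul _ hg]
  rw [lintegral_mul_const _ hf]

lemma lintegral_iterated_four {G : ℝ × ℝ × ℝ × ℝ → ℝ≥0∞} (hG : Measurable G) :
    ∫⁻ p, ∫⁻ q, ∫⁻ a, ∫⁻ b, G (p, q, a, b) = ∫⁻ z, G z := by
  have h1 : ∀ p, Measurable fun z : ℝ × ℝ × ℝ => G (p, z) := fun p => hG.comp (by fun_prop)
  have h2 : ∀ p q, Measurable fun z : ℝ × ℝ => G (p, q, z) := fun p q => hG.comp (by fun_prop)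
  rw [Measure.volume_eq_prod, lintegral_prod _ hG.aemeasurable]
  congr 1 with p
  rw [Measure.volume_eq_prod, lintegral_prod _ (h1 p).aemeasurable]
  congr 1 with q
  rw [Measure.volume_eq_prod, lintegral_prod _ (h2 p q).aemeasurable]

lemma integrableOn_exp_neg_mul_cosh {x : ℝ} (hx : 0 < x) :
    IntegrableOn (fun t => exp (-x * cosh t)) (Set.Ioi 0) := by
  refine (exp_neg_integrableOn_Ioi 0 hx).mono' (by fun_prop) ?_
  refine (ae_restrict_mem measurableSet_Ioi).mono fun t ht => ?_
  rw [norm_of_nonneg (exp_pos _).le]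
  have h1 := (self_lt_sinh_iff (x := t)).2 ht
  have h2 := sinh_lt_cosh t
  gcongr exp ?_
  nlinarith

lemma lintegral_even {f : ℝ → ℝ≥0∞} (hf : ∀ x, f (-x) = f x) :
    ∫⁻ x, f x = 2 * ∫⁻ x in Set.Ioi 0, f x := by
  have h : ∫⁻ x in Set.Iic 0, f x = ∫⁻ x in Set.Ioi 0, f x := by
    rw [setLIntegral_congr Ioi_ae_eq_Ici]
    have := (Measure.measurePreserving_neg (volume : Measure ℝ)).setLIntegral_comp_preimage_emb
      (MeasurableEquiv.neg ℝ).measurableEmbedding f (Set.Iic 0)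
    simpa [hf] using this.symm
  rw [← lintegral_add_compl f (measurableSet_Ioi (a := (0:ℝ))), Set.compl_Ioi, h, two_mul]

lemma ofReal_two_mul_besselK_zero {x : ℝ} (hx : 0 < x) :
    ENNReal.ofReal (2 * besselK 0 x) = ∫⁻ t, ENNReal.ofReal (exp (-(x * cosh t))) := by
  rw [lintegral_even (by simp), ENNReal.ofReal_mul two_pos.le, besselK,
    ofReal_integral_eq_lintegral_ofReal]
  · simp
  · simpa [IntegrableOn] using integrableOn_exp_neg_mul_cosh hx
  · exact Filter.Eventually.of_forall fun t => by positivity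

lemma lintegral_exp_neg_mul_cosh_sq (x : ℝ) :
    (∫⁻ t, ENNReal.ofReal (exp (-(x * cosh t)))) ^ 2 =
      2 * ∫⁻ u, ∫⁻ v, ENNReal.ofReal (exp (-(2 * x * (cosh u * cosh v)))) := by
  rw [sq, lintegral_mul_lintegral (by fun_prop) (by fun_prop), lintegral_lintegral_add_sub]
  · congr! 6 with u v
    rw [← ENNReal.ofReal_mul (exp_pos _).le, ← exp_add, cosh_add, cosh_sub]
    ring_nf
  · simp only [Function.uncurry_def]
    fun_prop

lemma lintegral_lintegral_sq {g : ℝ → ℝ → ℝ≥0∞} (hg : Measurable (Function.uncurry g)) :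
    (∫⁻ u, ∫⁻ v, g u v) ^ 2 =
      4 * ∫⁻ p, ∫⁻ q, ∫⁻ a, ∫⁻ b, g (p + q) (a + b) * g (p - q) (a - b) := by
  have h1 : ∀ u, Measurable (g u) := fun u => hg.comp (by fun_prop : Measurable fun v : ℝ => (u, v))
  have hcomp : ∀ {α : Type} [MeasurableSpace α] {f : α → ℝ × ℝ}, Measurable f →
      Measurable fun z => g (f z).1 (f z).2 := fun hf => hg.comp hf
  have h3 : ∀ u w, (∫⁻ v, g u v) * (∫⁻ v, g w v) = 2 * ∫⁻ a, ∫⁻ b, g u (a + b) * g w (a - b) := by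
    intro u w
    rw [lintegral_mul_lintegral (h1 _) (h1 _), lintegral_lintegral_add_sub]
    exact (hcomp (f := fun z : ℝ × ℝ => (u, z.1)) (by fun_prop)).mul
      (hcomp (f := fun z : ℝ × ℝ => (w, z.2)) (by fun_prop))
  have h4 : Measurable (Function.uncurry fun u w => ∫⁻ a, ∫⁻ b, g u (a + b) * g w (a - b)) := by
    refine Measurable.lintegral_prod_right (f := fun (z : ℝ × ℝ) a =>
      ∫⁻ b, g z.1 (a + b) * g z.2 (a - b)) ?_
    refine Measurable.lintegral_prod_right (f := fun (z : (ℝ × ℝ) × ℝ) b =>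
      g z.1.1 (z.2 + b) * g z.1.2 (z.2 - b)) ?_
    exact (hcomp (f := fun z : ((ℝ × ℝ) × ℝ) × ℝ => (z.1.1.1, z.1.2 + z.2)) (by fun_prop)).mul
      (hcomp (f := fun z : ((ℝ × ℝ) × ℝ) × ℝ => (z.1.1.2, z.1.2 - z.2)) (by fun_prop))
  have h5 : ∀ u, Measurable fun w => ∫⁻ a, ∫⁻ b, g u (a + b) * g w (a - b) :=
    fun u => h4.comp (by fun_prop : Measurable fun w : ℝ => (u, w))
  rw [sq, lintegral_mul_lintegral hg.lintegral_prod_right hg.lintegral_prod_right]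
  simp_rw [h3, lintegral_const_mul _ (h5 _)]
  rw [lintegral_const_mul _ h4.lintegral_prod_right, lintegral_lintegral_add_sub h4, ← mul_assoc]
  norm_num

lemma lintegral_exp_neg_mul_cosh_pow_four (x : ℝ) :
    (∫⁻ t, ENNReal.ofReal (exp (-(x * cosh t)))) ^ 4 =
      16 * ∫⁻ p, ∫⁻ q, ∫⁻ a, ∫⁻ b, ENNReal.ofReal (exp (-(4 *
        (cosh p * cosh q * cosh a * cosh b + sinh p * sinh q * sinh a * sinh b) * x))) := by
  have h : ∀ p q a b : ℝ,
      ENNReal.ofReal (exp (-(2 * x * (cosh (p + q) * cosh (a + b))))) *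
        ENNReal.ofReal (exp (-(2 * x * (cosh (p - q) * cosh (a - b))))) =
      ENNReal.ofReal (exp (-(4 *
        (cosh p * cosh q * cosh a * cosh b + sinh p * sinh q * sinh a * sinh b) * x))) := by
    intro p q a b
    rw [← ENNReal.ofReal_mul (exp_pos _).le, ← exp_add, cosh_add, cosh_sub, cosh_add, cosh_sub]
    ring_nf
  have hg : Measurable (Function.uncurry fun u v : ℝ =>
      ENNReal.ofReal (exp (-(2 * x * (cosh u * cosh v))))) := by
    simp only [Function.uncurry_def]
    fun_prop
  rw [show 4 = 2 * 2 from rfl, pow_mul, lintegral_exp_neg_mul_cosh_sq, mul_pow,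
    lintegral_lintegral_sq hg, ← mul_assoc]
  simp_rw [h]
  norm_num

lemma lintegral_mul_exp_neg_mul {c : ℝ} (hc : 0 < c) :
    ∫⁻ x in Set.Ioi (0:ℝ), ENNReal.ofReal (x * exp (-(c * x))) = ENNReal.ofReal (1 / c ^ 2) := by
  have h : ∫ x in Set.Ioi (0:ℝ), x * exp (-(c * x)) = 1 / c ^ 2 := by
    have := integral_rpow_mul_exp_neg_mul_Ioi (a := 2) two_pos hc
    norm_num at this
    simpa using this
  rw [← ofReal_integral_eq_lintegral_ofReal, h]
  · by_contra h'
    rw [integral_undef h'] at h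
    exact (by positivity : 1 / c ^ 2 ≠ 0) h.symm
  · exact (ae_restrict_mem measurableSet_Ioi).mono fun t (ht : 0 < t) => by
      simp only [Pi.zero_apply]; positivity

lemma lintegral_tanh_pow_div_cosh_sq (m : ℕ) :
    ∫⁻ x, ENNReal.ofReal (tanh x ^ (2 * m) / cosh x ^ 2) = ENNReal.ofReal (2 / (2 * m + 1)) := by
  have hd : ∀ x, HasDerivAt tanh (1 / cosh x ^ 2) x := fun x => by
    have h := (hasDerivAt_sinh x).div (hasDerivAt_cosh x) (cosh_pos x).ne'
    have e : tanh = fun y => sinh y / cosh y := funext tanh_eq_sinh_div_cosh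
    rw [e]
    refine h.congr_deriv ?_
    rw [← cosh_sq_sub_sinh_sq x]
    ring
  have h := lintegral_image_eq_lintegral_abs_deriv_mul MeasurableSet.univ
    (fun x _ => (hd x).hasDerivWithinAt) tanh_injective.injOn
    (fun y => ENNReal.ofReal (y ^ (2 * m)))
  rw [tanh_bijOn.image_eq] at h
  calc _ = ∫⁻ y in Set.Ioo (-1:ℝ) 1, ENNReal.ofReal (y ^ (2 * m)) := by
        rw [h, Measure.restrict_univ]
        congr! 2 with x
        rw [← ENNReal.ofReal_mul (abs_nonneg _), abs_of_pos (by have := cosh_pos x; positivity)]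
        ring_nf
    _ = _ := by
        rw [← ofReal_integral_eq_lintegral_ofReal, ← integral_Ioc_eq_integral_Ioo,
          ← intervalIntegral.integral_of_le (by norm_num), integral_pow]
        · congr 1
          push_cast
          rw [Odd.neg_one_pow ⟨m, rfl⟩]
          norm_num
        · exact ((by fun_prop : Continuous fun y : ℝ => y ^ (2 * m)).integrableOn_Icc
            (a := -1) (b := 1)).mono_set Set.Ioo_subset_Icc_self
        · exact Filter.Eventually.of_forall fun t => (even_two_mul m).pow_nonneg t

lemma hasSum_odd_mul_pow {c : ℝ} (hc : |c| < 1) :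
    HasSum (fun m : ℕ => (2 * m + 1) * c ^ (2 * m))
      (1 / 2 * (1 / (1 + c) ^ 2 + 1 / (1 - c) ^ 2)) := by
  have h2 : ‖c ^ 2‖ < 1 := by
    rw [norm_pow, norm_eq_abs]; exact pow_lt_one₀ (abs_nonneg _) hc two_ne_zero
  have h := ((hasSum_coe_mul_geometric_of_norm_lt_one h2).mul_left 2).add
    (hasSum_geometric_of_norm_lt_one h2)
  obtain ⟨ha, hb⟩ := abs_lt.1 hc
  have h1 : 1 + c ≠ 0 := by linarith
  have h2 : 1 - c ≠ 0 := by linarith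
  have h3 : 1 - c ^ 2 ≠ 0 := by
    rw [show 1 - c ^ 2 = (1 + c) * (1 - c) by ring]; exact mul_ne_zero h1 h2
  have h4 : 2 * (c ^ 2 / (1 - c ^ 2) ^ 2) + (1 - c ^ 2)⁻¹ =
      1 / 2 * (1 / (1 + c) ^ 2 + 1 / (1 - c) ^ 2) := by
    field_simp
    ring
  rw [h4] at h
  refine h.congr_fun fun m => ?_
  rw [pow_mul]
  ring

lemma cosh_mul_add_sinh_mul_eq (p q a b : ℝ) :
    cosh p * cosh q * cosh a * cosh b + sinh p * sinh q * sinh a * sinh b =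
      cosh p * cosh q * cosh a * cosh b * (1 + tanh p * tanh q * tanh a * tanh b) := by
  have := (cosh_pos p).ne'
  have := (cosh_pos q).ne'
  have := (cosh_pos a).ne'
  have := (cosh_pos b).ne'
  simp only [tanh_eq_sinh_div_cosh]
  field_simp

lemma abs_tanh_mul_lt_one (p q a b : ℝ) : |tanh p * tanh q * tanh a * tanh b| < 1 := by
  simp only [abs_mul]
  have hp := abs_tanh_lt_one p
  have hq := abs_tanh_lt_one q
  have ha := abs_tanh_lt_one a
  have hb := abs_tanh_lt_one b
  refine mul_lt_one_of_nonneg_of_lt_one_right ?_ (abs_nonneg _) hb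
  refine mul_le_one₀ (mul_le_one₀ hp.le (abs_nonneg _) hq.le) (abs_nonneg _) ha.le

lemma cosh_mul_add_sinh_mul_pos (p q a b : ℝ) :
    0 < cosh p * cosh q * cosh a * cosh b + sinh p * sinh q * sinh a * sinh b := by
  rw [cosh_mul_add_sinh_mul_eq]
  have := (abs_lt.1 (abs_tanh_mul_lt_one p q a b)).1
  have := cosh_pos p
  have := cosh_pos q
  have := cosh_pos a
  have := cosh_pos b
  have : 0 < 1 + tanh p * tanh q * tanh a * tanh b := by linarith
  positivity

lemma lintegral_symmetrize {f : ℝ → ℝ} (hf : Measurable f) (h0 : ∀ x, 0 ≤ f x) :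
    ∫⁻ x, ENNReal.ofReal (f x) = ∫⁻ x, ENNReal.ofReal (1 / 2 * (f x + f (-x))) := by
  have h : ∫⁻ x, ENNReal.ofReal (f (-x)) = ∫⁻ x, ENNReal.ofReal (f x) :=
    lintegral_neg_eq_self (μ := volume) (fun x => ENNReal.ofReal (f x))
  simp_rw [ENNReal.ofReal_mul (by norm_num : (0:ℝ) ≤ 1 / 2), ENNReal.ofReal_add (h0 _) (h0 _)]
  rw [lintegral_const_mul _ (by fun_prop), lintegral_add_left (by fun_prop), h, ← two_mul,
    ← mul_assoc, ← ENNReal.ofReal_ofNat 2, ← ENNReal.ofReal_mul (by norm_num)]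
  norm_num

lemma measurable_tanh : Measurable tanh := by
  rw [funext tanh_eq_sinh_div_cosh]
  fun_prop

lemma lintegral_one_div_sq_eq_tsum :
    ∫⁻ p, ∫⁻ q, ∫⁻ a, ∫⁻ b, ENNReal.ofReal (1 /
        (cosh p * cosh q * cosh a * cosh b + sinh p * sinh q * sinh a * sinh b) ^ 2) =
      ∑' m : ℕ, ENNReal.ofReal (16 * (1 / (2 * m + 1) ^ 3)) := by
  let T : ℕ → ℝ → ℝ≥0∞ := fun m x => ENNReal.ofReal (tanh x ^ (2 * m) / cosh x ^ 2)
  have hT : ∀ m, Measurable (T m) := fun m => by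
    have := measurable_tanh
    fun_prop
  have hTtop : ∀ m x, T m x ≠ ⊤ := fun _ _ => ENNReal.ofReal_ne_top
  have hTnn : ∀ m x, 0 ≤ tanh x ^ (2 * m) / cosh x ^ 2 := fun m x =>
    div_nonneg ((even_two_mul m).pow_nonneg _) (sq_nonneg _)
  have hsum : ∀ p q a b, ENNReal.ofReal (1 / 2 * (1 /
        (cosh p * cosh q * cosh a * cosh b + sinh p * sinh q * sinh a * sinh b) ^ 2 + 1 /
        (cosh p * cosh q * cosh a * cosh (-b) + sinh p * sinh q * sinh a * sinh (-b)) ^ 2)) =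
      ∑' m : ℕ, ENNReal.ofReal (2 * m + 1) * (T m p * (T m q * (T m a * T m b))) := by
    intro p q a b
    have h := (hasSum_odd_mul_pow (abs_tanh_mul_lt_one p q a b)).mul_left
      (1 / (cosh p * cosh q * cosh a * cosh b) ^ 2)
    have hterm : ∀ m : ℕ, 1 / (cosh p * cosh q * cosh a * cosh b) ^ 2 *
        ((2 * m + 1) * (tanh p * tanh q * tanh a * tanh b) ^ (2 * m)) =
        (2 * m + 1) * (tanh p ^ (2 * m) / cosh p ^ 2 * (tanh q ^ (2 * m) / cosh q ^ 2 *
          (tanh a ^ (2 * m) / cosh a ^ 2 * (tanh b ^ (2 * m) / cosh b ^ 2)))) := by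
      intro m
      simp only [mul_pow, div_eq_mul_inv, mul_inv]
      ring
    simp only [hterm] at h
    have hnn : ∀ m : ℕ, 0 ≤ (2 * m + 1) * (tanh p ^ (2 * m) / cosh p ^ 2 *
        (tanh q ^ (2 * m) / cosh q ^ 2 *
          (tanh a ^ (2 * m) / cosh a ^ 2 * (tanh b ^ (2 * m) / cosh b ^ 2)))) := fun m =>
      mul_nonneg (by positivity) (mul_nonneg (hTnn _ _) (mul_nonneg (hTnn _ _)
        (mul_nonneg (hTnn _ _) (hTnn _ _))))
    rw [cosh_mul_add_sinh_mul_eq, cosh_mul_add_sinh_mul_eq, cosh_neg, tanh_neg, mul_neg,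
      ← sub_eq_add_neg]
    calc _ = ENNReal.ofReal (∑' m : ℕ, (2 * m + 1) * (tanh p ^ (2 * m) / cosh p ^ 2 *
        (tanh q ^ (2 * m) / cosh q ^ 2 *
          (tanh a ^ (2 * m) / cosh a ^ 2 * (tanh b ^ (2 * m) / cosh b ^ 2))))) := by
          rw [h.tsum_eq]
          congr 1
          rw [mul_pow, mul_pow _ (1 - _), one_div_mul_eq_div, one_div_mul_eq_div]
          simp only [div_eq_mul_inv, mul_inv]
          ring
      _ = _ := by
          rw [ENNReal.ofReal_tsum_of_nonneg hnn h.summable]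
          refine tsum_congr fun m => ?_
          rw [ENNReal.ofReal_mul (by positivity), ENNReal.ofReal_mul (hTnn _ _),
            ENNReal.ofReal_mul (hTnn _ _), ENNReal.ofReal_mul (hTnn _ _)]
  have hG : ∀ m : ℕ, Measurable fun z : ℝ × ℝ × ℝ × ℝ =>
      T m z.1 * (T m z.2.1 * (T m z.2.2.1 * T m z.2.2.2)) := fun m => by
    have := hT m
    fun_prop
  calc _ = ∫⁻ p, ∫⁻ q, ∫⁻ a, ∫⁻ b, ∑' m : ℕ,
        ENNReal.ofReal (2 * m + 1) * (T m p * (T m q * (T m a * T m b))) := by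
        refine lintegral_congr fun p => lintegral_congr fun q => lintegral_congr fun a => ?_
        rw [lintegral_symmetrize (by fun_prop) fun b => by positivity]
        exact lintegral_congr fun b => hsum p q a b
    _ = ∫⁻ z : ℝ × ℝ × ℝ × ℝ, ∑' m : ℕ,
        ENNReal.ofReal (2 * m + 1) * (T m z.1 * (T m z.2.1 * (T m z.2.2.1 * T m z.2.2.2))) :=
        lintegral_iterated_four (Measurable.tsum fun m => (hG m).const_mul _)
    _ = ∑' m : ℕ, ENNReal.ofReal (2 * m + 1) * ((∫⁻ x, T m x) ^ 4) := by
        rw [lintegral_tsum fun m => ((hG m).const_mul _).aemeasurable]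
        refine tsum_congr fun m => ?_
        rw [lintegral_const_mul _ (hG m), ← lintegral_iterated_four (hG m)]
        simp_rw [lintegral_const_mul' _ _ (hTtop m _)]
        simp_rw [lintegral_mul_const _ (hT m)]
        ring_nf
    _ = _ := by
        refine tsum_congr fun m => ?_
        rw [lintegral_tanh_pow_div_cosh_sq, ← ENNReal.ofReal_pow (by positivity),
          ← ENNReal.ofReal_mul (by positivity)]
        congr 1
        field_simp
        norm_num

lemma lintegral_mul_lintegral_exp_pow_four :
    ∫⁻ x in Set.Ioi (0:ℝ), ENNReal.ofReal x *
        (∫⁻ t, ENNReal.ofReal (exp (-(x * cosh t)))) ^ 4 =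
      ∑' m : ℕ, ENNReal.ofReal (16 * (1 / (2 * m + 1) ^ 3)) := by
  rw [← lintegral_one_div_sq_eq_tsum]
  have hE : ∀ x, Measurable fun z : ℝ × ℝ × ℝ × ℝ => ENNReal.ofReal (exp (-(4 *
      (cosh z.1 * cosh z.2.1 * cosh z.2.2.1 * cosh z.2.2.2 +
        sinh z.1 * sinh z.2.1 * sinh z.2.2.1 * sinh z.2.2.2) * x))) := fun x => by fun_prop
  have hD : Measurable fun z : ℝ × ℝ × ℝ × ℝ => ENNReal.ofReal (1 /
      (cosh z.1 * cosh z.2.1 * cosh z.2.2.1 * cosh z.2.2.2 +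
        sinh z.1 * sinh z.2.1 * sinh z.2.2.1 * sinh z.2.2.2) ^ 2) := by fun_prop
  rw [lintegral_iterated_four hD]
  calc _ = ∫⁻ x in Set.Ioi (0:ℝ), ∫⁻ z : ℝ × ℝ × ℝ × ℝ, 16 * ENNReal.ofReal (x * exp (-(4 *
      (cosh z.1 * cosh z.2.1 * cosh z.2.2.1 * cosh z.2.2.2 +
        sinh z.1 * sinh z.2.1 * sinh z.2.2.1 * sinh z.2.2.2) * x))) := by
        refine setLIntegral_congr_fun measurableSet_Ioi fun x (hx : 0 < x) => ?_
        simp only [lintegral_exp_neg_mul_cosh_pow_four]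
        rw [lintegral_iterated_four (hE x), mul_left_comm, ← lintegral_const_mul _ (hE x),
          ← lintegral_const_mul _ ((hE x).const_mul _)]
        simp_rw [← ENNReal.ofReal_mul hx.le]
    _ = ∫⁻ z : ℝ × ℝ × ℝ × ℝ, ∫⁻ x in Set.Ioi (0:ℝ), 16 * ENNReal.ofReal (x * exp (-(4 *
      (cosh z.1 * cosh z.2.1 * cosh z.2.2.1 * cosh z.2.2.2 +
        sinh z.1 * sinh z.2.1 * sinh z.2.2.1 * sinh z.2.2.2) * x))) := by
        refine lintegral_lintegral_swap (Measurable.aemeasurable ?_)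
        simp only [Function.uncurry_def]
        fun_prop
    _ = _ := by
        refine lintegral_congr fun z => ?_
        have h := cosh_mul_add_sinh_mul_pos z.1 z.2.1 z.2.2.1 z.2.2.2
        rw [lintegral_const_mul _ (by fun_prop), lintegral_mul_exp_neg_mul (by positivity),
          ← ENNReal.ofReal_ofNat 16, ← ENNReal.ofReal_mul (by norm_num)]
        congr 1
        field_simp
        norm_num

lemma hasSum_one_div_odd_cube :
    HasSum (fun m : ℕ => 1 / (2 * (m : ℝ) + 1) ^ 3) (7 / 8 * ∑' k : ℕ, 1 / ((k : ℝ) + 1) ^ 3) := by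
  have hs : Summable fun k : ℕ => 1 / ((k : ℝ) + 1) ^ 3 := by
    have := (summable_nat_add_iff 1).2 (summable_one_div_nat_pow.2 (by norm_num : 1 < 3))
    simpa using this
  obtain ⟨f, hf⟩ : ∃ f : ℕ → ℝ, ∀ k, f k = 1 / ((k : ℝ) + 1) ^ 3 := ⟨_, fun _ => rfl⟩
  simp only [← hf] at hs ⊢
  have h0 : Summable fun m => f (2 * m) := hs.comp_injective fun a b h => by simpa using h
  have h1 : Summable fun m => f (2 * m + 1) := hs.comp_injective fun a b h => by simpa using h
  have h := tsum_even_add_odd h0 h1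
  have h2 : ∑' m, f (2 * m + 1) = 1 / 8 * ∑' k, f k := by
    rw [← tsum_mul_left]
    refine tsum_congr fun m => ?_
    rw [hf, hf]
    push_cast
    field_simp
    ring
  have h3 := h0.hasSum
  rw [show ∑' m, f (2 * m) = 7 / 8 * ∑' k, f k by linarith] at h3
  simpa [hf] using h3

lemma measurable_besselK_zero : Measurable (besselK 0) := by
  have : StronglyMeasurable (Function.uncurry fun x t : ℝ => exp (-x * cosh t) * cosh (0 * t)) := by
    simp only [Function.uncurry_def]
    exact Continuous.stronglyMeasurable (by fun_prop)
  exact (this.integral_prod_right (ν := volume.restrict (Set.Ioi 0))).measurable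

lemma besselK_zero_nonneg (x : ℝ) : 0 ≤ besselK 0 x :=
  integral_nonneg fun t => by positivity

lemma integral_mul_besselK_zero_pow_four :
    ∫ x in Set.Ioi (0:ℝ), x * besselK 0 x ^ 4 = 7 / 8 * ∑' k : ℕ, 1 / ((k : ℝ) + 1) ^ 3 := by
  have h : ∫ x in Set.Ioi (0:ℝ), x * (2 * besselK 0 x) ^ 4 =
      16 * (7 / 8 * ∑' k : ℕ, 1 / ((k : ℝ) + 1) ^ 3) := by
    have hK := measurable_besselK_zero
    rw [integral_eq_lintegral_of_nonneg_ae
      ((ae_restrict_mem measurableSet_Ioi).mono fun x (hx : 0 < x) => by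
        have := besselK_zero_nonneg x
        simp only [Pi.zero_apply]
        positivity) (by fun_prop)]
    have hs := hasSum_one_div_odd_cube.mul_left 16
    rw [← hs.tsum_eq, ← ENNReal.toReal_ofReal (tsum_nonneg fun m => by positivity),
      ENNReal.ofReal_tsum_of_nonneg (fun m => by positivity) hs.summable,
      ← lintegral_mul_lintegral_exp_pow_four]
    congr 1
    refine setLIntegral_congr_fun measurableSet_Ioi fun x (hx : 0 < x) => ?_
    have := besselK_zero_nonneg x
    simp only [← ofReal_two_mul_besselK_zero hx]
    rw [ENNReal.ofReal_mul hx.le, ENNReal.ofReal_pow (by positivity)]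
  have h2 : ∀ x, x * (2 * besselK 0 x) ^ 4 = 16 * (x * besselK 0 x ^ 4) := fun x => by ring
  simp_rw [h2] at h
  rw [integral_const_mul] at h
  linarith

theorem stmt6 (a : ℝ) (ha : 0 < a) :
    (∫ x in Set.Ioi (0:ℝ), x * (besselK 0 (a * x)) ^ 4)
    = (7 / (8 * a ^ 2)) * ∑' k : ℕ, 1 / ((k : ℝ) + 1) ^ 3 := by
  have h := integral_comp_mul_left_Ioi (fun y => y * besselK 0 y ^ 4) 0 ha
  have h2 : ∀ x, a * x * besselK 0 (a * x) ^ 4 = a * (x * besselK 0 (a * x) ^ 4) :=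
    fun x => by ring
  simp only [h2, mul_zero, smul_eq_mul] at h
  rw [integral_const_mul, integral_mul_besselK_zero_pow_four] at h
  field_simp at h ⊢
  linarith
end
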